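/- arXiv:1210.4229 — 2 statements merged into one kernel-verified Lean document; each statement's English description precedes it below -/
import Mathlib

section
/- Let N ≥ 1 and let μ₁, μ₂, μ₃ be real numbers with μ_k > μ̄ ≥ 0 for k = 1,2,3. Then there exists a constant C > 0 such that for all x₁, x₂, x₃ ∈ ℝ^N one has ∫_{ℝ^N} e^{−μ₁|x−x₁|} · e^{−μ₂|x−x₂|} · e^{−μ₃|x−x₃|} dx ≤ C · exp(−μ̄ · inf_{x ∈ ℝ^N} (|x−x₁| + |x−x₂| + |x−x₃|)). -/
open MeasureTheory Real

lemma integrable_exp_neg_mul_norm {E : Type*} [NormedAddCommGroup E] [NormedSpace ℝ E]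
    [FiniteDimensional ℝ E] [MeasurableSpace E] [BorelSpace E] (μ : Measure E)
    [μ.IsAddHaarMeasure] {b : ℝ} (hb : 0 < b) :
    Integrable (fun x : E => Real.exp (-b * ‖x‖)) μ := by
  set n := Module.finrank ℝ E + 1 with hn
  have hr : (Module.finrank ℝ E : ℝ) < (n : ℝ) := by rw [hn]; push_cast; linarith
  refine ((integrable_one_add_norm (μ := μ) hr).const_mul
    (Real.exp b * (n.factorial / b ^ n))).mono' (by fun_prop) (Filter.Eventually.of_forall fun x => ?_)
  have hx : 0 < 1 + ‖x‖ := by positivity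
  have key := Real.pow_div_factorial_le_exp (b * (1 + ‖x‖)) (by positivity) n
  rw [Real.norm_of_nonneg (Real.exp_pos _).le, Real.rpow_neg hx.le, Real.rpow_natCast]
  have hsplit : Real.exp (-b * ‖x‖) = Real.exp b * (Real.exp (b * (1 + ‖x‖)))⁻¹ := by
    rw [← Real.exp_neg, ← Real.exp_add]; ring_nf
  rw [hsplit, mul_assoc]
  gcongr
  calc (Real.exp (b * (1 + ‖x‖)))⁻¹
      ≤ ((b * (1 + ‖x‖)) ^ n / n.factorial)⁻¹ := by gcongr
    _ = n.factorial / b ^ n * ((1 + ‖x‖) ^ n)⁻¹ := by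
      rw [mul_pow, inv_div, div_mul_eq_div_mul_one_div, one_div, div_eq_mul_inv _ (b ^ n)]

theorem stmt_1 (N : ℕ) (hN : 1 ≤ N) (μbar μ₁ μ₂ μ₃ : ℝ)
    (hμbar : 0 ≤ μbar) (h₁ : μbar < μ₁) (h₂ : μbar < μ₂) (h₃ : μbar < μ₃) :
    ∃ C > (0 : ℝ), ∀ x₁ x₂ x₃ : EuclideanSpace ℝ (Fin N),
      (∫ x : EuclideanSpace ℝ (Fin N),
          Real.exp (-μ₁ * dist x x₁) * Real.exp (-μ₂ * dist x x₂) *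
            Real.exp (-μ₃ * dist x x₃))
        ≤ C * Real.exp (-μbar *
            ⨅ x : EuclideanSpace ℝ (Fin N), (dist x x₁ + dist x x₂ + dist x x₃)) := by
  have hint := integrable_exp_neg_mul_norm
    (volume : Measure (EuclideanSpace ℝ (Fin N))) (sub_pos.2 h₁)
  refine ⟨∫ x : EuclideanSpace ℝ (Fin N), Real.exp (-(μ₁ - μbar) * ‖x‖),
    integral_exp_pos hint, fun x₁ x₂ x₃ => ?_⟩
  rw [← integral_sub_right_eq_self (fun x => Real.exp (-(μ₁ - μbar) * ‖x‖)) x₁,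
    ← integral_mul_const]
  refine integral_mono_of_nonneg (Filter.Eventually.of_forall fun x => by positivity)
    ((hint.comp_sub_right x₁).mul_const _) (Filter.Eventually.of_forall fun x => ?_)
  have hinf : ⨅ y : EuclideanSpace ℝ (Fin N), (dist y x₁ + dist y x₂ + dist y x₃)
      ≤ dist x x₁ + dist x x₂ + dist x x₃ :=
    ciInf_le ⟨0, by rintro _ ⟨y, rfl⟩; positivity⟩ x
  have hmul := mul_le_mul_of_nonneg_left hinf hμbar
  have hd₂ := mul_le_mul_of_nonneg_right h₂.le (dist_nonneg (x := x) (y := x₂))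
  have hd₃ := mul_le_mul_of_nonneg_right h₃.le (dist_nonneg (x := x) (y := x₃))
  simp only [← Real.exp_add, ← dist_eq_norm]
  exact Real.exp_le_exp.2 (by linarith)
end

section
/- Assume f : ℝ → ℝ is continuously differentiable on ℝ and three times continuously differentiable on ℝ∖{0}, and there exist C > 0 and exponents p₁, p₂ with 1 < p₁ ≤ p₂ such that |f^{(k)}(u)| ≤ C(|u|^{p₁−k} + |u|^{p₂−k}) for k = 0,1,2,3 and all u ≠ 0. Set α := min{(p₁+1)/4, 1} and F(u) := ∫₀^u f(s) ds. For every C̃₁ ≥ 1 and every n ∈ ℕ there is a constant C̃₂ > 0 such that for all u₁, …, u_n ∈ ℝ with |u_i| ≤ C̃₁ for every i, one has |F(∑_{i=1}^n u_i) − ∑_{i=1}^n F(u_i) − ∑_{i ≠ j} f(u_i)u_j| ≤ C̃₂ · (∑_{1 ≤ i < j ≤ n} |u_i u_j|^{2α} + ∑_{1 ≤ i < j < k ≤ n} |u_i u_j u_k|^{2/3}). -/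
lemma rpow_mul_sq_le_mul_rpow {a b q : ℝ} (hb : 0 ≤ b) (hba : b ≤ a) (hq : 1 ≤ q) (hq2 : q ≤ 2) :
    a ^ (2 * q - 2) * b ^ 2 ≤ (a * b) ^ q := by
  rcases hb.eq_or_lt with rfl | hb
  · rw [mul_zero, Real.zero_rpow (by linarith)]
    simp
  have ha : 0 < a := hb.trans_le hba
  calc a ^ (2 * q - 2) * b ^ 2 = a ^ (2 * q - 2) * (b ^ q * b ^ (2 - q)) := by
        rw [← Real.rpow_add hb, ← Real.rpow_natCast b 2]
        norm_num
    _ ≤ a ^ (2 * q - 2) * (b ^ q * a ^ (2 - q)) := by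
        have := Real.rpow_le_rpow hb.le hba (by linarith : 0 ≤ 2 - q)
        gcongr
    _ = (a ^ (2 * q - 2) * a ^ (2 - q)) * b ^ q := by ring
    _ = (a * b) ^ q := by
        rw [← Real.rpow_add ha, Real.mul_rpow ha.le hb.le]
        congr 2
        ring

lemma rpow_mul_mul_le_mul_rpow {a b q : ℝ} (hb : 0 ≤ b) (hba : b ≤ a) (hq : 1 ≤ q) :
    b ^ (2 * q - 2) * b * a ≤ (a * b) ^ q := by
  rcases hb.eq_or_lt with rfl | hb
  · simpa using Real.rpow_nonneg le_rfl q
  have ha : 0 < a := hb.trans_le hba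
  calc b ^ (2 * q - 2) * b * a = b ^ q * b ^ (q - 1) * a := by
        rw [← Real.rpow_add_one hb.ne', ← Real.rpow_add hb]
        congr 2
        ring
    _ ≤ b ^ q * a ^ (q - 1) * a := by
        have := Real.rpow_le_rpow hb.le hba (by linarith : 0 ≤ q - 1)
        gcongr
    _ = (a * b) ^ q := by
        rw [mul_assoc, ← Real.rpow_add_one ha.ne', Real.mul_rpow ha.le hb.le]
        ring_nf

lemma mul_le_rpow_two_thirds {a b c : ℝ} (hb : 0 ≤ b) (hc : 0 ≤ c) (hba : b ≤ a) (hca : c ≤ a) :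
    b * c ≤ (a * b * c) ^ ((2 : ℝ) / 3) := by
  have ha : 0 ≤ a := hb.trans hba
  have h : ((b * c) ^ (3 : ℝ)) ^ ((1 : ℝ) / 3) ≤ ((a * b * c) ^ (2 : ℝ)) ^ ((1 : ℝ) / 3) := by
    apply Real.rpow_le_rpow (by positivity) _ (by norm_num)
    norm_cast
    calc (b * c) ^ 3 = (b * c) ^ 2 * (b * c) := by ring
      _ ≤ (b * c) ^ 2 * (a * a) := by gcongr
      _ = (a * b * c) ^ 2 := by ring
  rw [← Real.rpow_mul (by positivity), ← Real.rpow_mul (by positivity)] at h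
  norm_num at h
  exact h

lemma exists_abs_sum_rpow_le (n : ℕ) {r : ℝ} (hr : 0 < r) :
    ∃ K > (0 : ℝ), ∀ u : Fin n → ℝ, |∑ i, u i| ^ r ≤ K * ∑ i, |u i| ^ r := by
  refine ⟨(n + 1 : ℝ) ^ r, by positivity, fun u => ?_⟩
  rcases isEmpty_or_nonempty (Fin n) with h | h
  · simp [Real.zero_rpow hr.ne']
  obtain ⟨m, hm⟩ := Finite.exists_max fun i => |u i|
  calc |∑ i, u i| ^ r ≤ ((n + 1 : ℝ) * |u m|) ^ r := by
        apply Real.rpow_le_rpow (abs_nonneg _) _ hr.le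
        calc |∑ i, u i| ≤ ∑ i, |u i| := Finset.abs_sum_le_sum_abs _ _
          _ ≤ ∑ _i : Fin n, |u m| := Finset.sum_le_sum fun i _ => hm i
          _ = n * |u m| := by simp
          _ ≤ _ := by gcongr; linarith
    _ = (n + 1 : ℝ) ^ r * |u m| ^ r := Real.mul_rpow (by positivity) (abs_nonneg _)
    _ ≤ _ := by
        gcongr
        exact Finset.single_le_sum (f := fun i => |u i| ^ r) (fun i _ => by positivity)
          (Finset.mem_univ m)

lemma abs_sub_le_of_abs_deriv_le {f : ℝ → ℝ} (hf : Differentiable ℝ f) {M ρ x y : ℝ}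
    (hM : ∀ u, |u| ≤ ρ → |deriv f u| ≤ M) (hx : |x| ≤ ρ) (hy : |y| ≤ ρ) :
    |f x - f y| ≤ M * |x - y| := by
  have := (convex_Icc (-ρ) ρ).norm_image_sub_le_of_norm_deriv_le (f := f) (C := M)
    (fun u _ => hf u) (fun u hu => hM u (abs_le.2 hu)) (abs_le.1 hy) (abs_le.1 hx)
  simpa using this

lemma abs_sub_sub_mul_le {f F : ℝ → ℝ} (hf : Differentiable ℝ f) (hF : ∀ x, HasDerivAt F (f x) x)
    {M ρ x y : ℝ} (hM : ∀ u, |u| ≤ ρ → |deriv f u| ≤ M) (hx : |x| ≤ ρ) (hy : |y| ≤ ρ) :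
    |F x - F y - f y * (x - y)| ≤ M * |x - y| ^ 2 := by
  have hM0 : 0 ≤ M := (abs_nonneg _).trans (hM x hx)
  have hG : ∀ u, HasDerivAt (fun u => F u - f y * u) (f u - f y) u := fun u => by
    simpa using (hF u).fun_sub ((hasDerivAt_id u).const_mul (f y))
  have := (convex_uIcc y x).norm_image_sub_le_of_norm_deriv_le (f := fun u => F u - f y * u)
    (C := M * |x - y|) (fun u _ => (hG u).differentiableAt) (fun u hu => ?_)
    Set.left_mem_uIcc Set.right_mem_uIcc
  · rw [Real.norm_eq_abs, Real.norm_eq_abs] at this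
    convert this using 1
    · congr 1; ring
    · ring
  · rw [(hG u).deriv, Real.norm_eq_abs]
    have hu' : |u| ≤ ρ := abs_le.2 (Set.uIcc_subset_Icc (abs_le.1 hy) (abs_le.1 hx) hu)
    refine (abs_sub_le_of_abs_deriv_le hf hM hu' hy).trans ?_
    exact mul_le_mul_of_nonneg_left (Set.abs_sub_left_of_mem_uIcc hu) hM0

/-- Local growth of order `2 * q - 2` for the derivative of `f`. -/
def DerivGrowth (f : ℝ → ℝ) (q : ℝ) : Prop :=
  ∀ R > (0 : ℝ), ∃ K > (0 : ℝ), ∀ u, |u| ≤ R → |deriv f u| ≤ K * |u| ^ (2 * q - 2)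

section

variable {f F : ℝ → ℝ} {q : ℝ}

lemma DerivGrowth.exists_bounds (h : DerivGrowth f q) (hf : Differentiable ℝ f) (hf0 : f 0 = 0)
    (hF : ∀ x, HasDerivAt F (f x) x) (hF0 : F 0 = 0) (hq : 1 < q) (hq2 : q ≤ 2)
    {R : ℝ} (hR : 0 < R) :
    ∃ K > (0 : ℝ), ∀ a b, |a| ≤ R → |b| ≤ |a| →
      |f b| ≤ K * |b| ^ (2 * q - 2) * |b| ∧
      |F b| ≤ K * |b| ^ (2 * q - 2) * |b| ^ 2 ∧
      |f (a + b) - f a| ≤ 4 * K * |a| ^ (2 * q - 2) * |b| ∧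
      |F (a + b) - F a - f a * b| ≤ 4 * K * |a| ^ (2 * q - 2) * |b| ^ 2 := by
  obtain ⟨K, hK, hKf⟩ := h (2 * R) (by positivity)
  refine ⟨K, hK, fun a b ha hb => ?_⟩
  have hM : ∀ ρ, ρ ≤ 2 * R → ∀ u, |u| ≤ ρ → |deriv f u| ≤ K * ρ ^ (2 * q - 2) := by
    intro ρ hρ u hu
    refine (hKf u (hu.trans hρ)).trans ?_
    have := Real.rpow_le_rpow (abs_nonneg u) hu (by linarith : 0 ≤ 2 * q - 2)
    gcongr
  have h4 : K * (2 * |a|) ^ (2 * q - 2) ≤ 4 * K * |a| ^ (2 * q - 2) := by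
    rw [Real.mul_rpow (by norm_num) (abs_nonneg a)]
    have : (2 : ℝ) ^ (2 * q - 2) ≤ 4 := by
      calc (2 : ℝ) ^ (2 * q - 2) ≤ 2 ^ (2 : ℝ) :=
            Real.rpow_le_rpow_of_exponent_le (by norm_num) (by linarith)
        _ = 4 := by norm_num
    calc _ = 2 ^ (2 * q - 2) * K * |a| ^ (2 * q - 2) := by ring
      _ ≤ _ := by gcongr
  have hab : |a + b| ≤ 2 * |a| := (abs_add_le a b).trans (by linarith)
  have ha2 : |a| ≤ 2 * |a| := by linarith [abs_nonneg a]
  have hb0 : |(0 : ℝ)| ≤ |b| := by simp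
  have Mb := hM |b| (by linarith)
  have Ma := fun u hu => (hM (2 * |a|) (by linarith) u hu).trans h4
  have h1 := abs_sub_le_of_abs_deriv_le hf Mb le_rfl hb0
  have h2 := abs_sub_sub_mul_le hf hF Mb le_rfl hb0
  have h3 := abs_sub_le_of_abs_deriv_le hf Ma hab ha2
  have h4 := abs_sub_sub_mul_le hf hF Ma hab ha2
  simp only [hf0, hF0, sub_zero, zero_mul, add_sub_cancel_left] at h1 h2 h3 h4
  exact ⟨h1, h2, h3, h4⟩

lemma DerivGrowth.exists_two_primitive (h : DerivGrowth f q) (hf : Differentiable ℝ f)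
    (hf0 : f 0 = 0) (hF : ∀ x, HasDerivAt F (f x) x) (hF0 : F 0 = 0) (hq : 1 < q) (hq2 : q ≤ 2)
    {R : ℝ} (hR : 0 < R) :
    ∃ K > (0 : ℝ), ∀ a b, |a| ≤ R → |b| ≤ R →
      |F (a + b) - F a - F b - f a * b - f b * a| ≤ K * |a * b| ^ q := by
  obtain ⟨K, hK, hB⟩ := h.exists_bounds hf hf0 hF hF0 hq hq2 hR
  have key : ∀ a b, |a| ≤ R → |b| ≤ |a| →
      |F (a + b) - F a - F b - f a * b - f b * a| ≤ 6 * K * |a * b| ^ q := by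
    intro a b ha hb
    obtain ⟨h1, h2, -, h4⟩ := hB a b ha hb
    have e1 := rpow_mul_sq_le_mul_rpow (abs_nonneg b) hb hq.le hq2
    have e2 := rpow_mul_mul_le_mul_rpow (abs_nonneg b) hb hq.le
    have e3 : |b| ^ (2 * q - 2) * |b| ^ 2 ≤ (|a| * |b|) ^ q := by
      refine le_trans ?_ e2
      rw [pow_two, mul_assoc]
      gcongr
    rw [abs_mul]
    calc |F (a + b) - F a - F b - f a * b - f b * a|
        = |(F (a + b) - F a - f a * b) - F b - f b * a| := by congr 1; ring
      _ ≤ |F (a + b) - F a - f a * b| + |F b| + |f b * a| :=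
          (abs_sub _ _).trans (add_le_add_left (abs_sub _ _) _)
      _ ≤ 4 * K * |a| ^ (2 * q - 2) * |b| ^ 2 + K * |b| ^ (2 * q - 2) * |b| ^ 2
          + K * |b| ^ (2 * q - 2) * |b| * |a| := by
          rw [abs_mul]
          gcongr
      _ = 4 * K * (|a| ^ (2 * q - 2) * |b| ^ 2) + K * (|b| ^ (2 * q - 2) * |b| ^ 2)
          + K * (|b| ^ (2 * q - 2) * |b| * |a|) := by ring
      _ ≤ 4 * K * (|a| * |b|) ^ q + K * (|a| * |b|) ^ q + K * (|a| * |b|) ^ q := by gcongr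
      _ = 6 * K * (|a| * |b|) ^ q := by ring
  refine ⟨6 * K, by positivity, fun a b ha hb => ?_⟩
  rcases le_total |b| |a| with hab | hab
  · exact key a b ha hab
  · have := key b a hb hab
    rw [mul_comm b a, add_comm b a] at this
    convert this using 2
    ring

lemma DerivGrowth.exists_two_mul (h : DerivGrowth f q) (hf : Differentiable ℝ f)
    (hf0 : f 0 = 0) (hF : ∀ x, HasDerivAt F (f x) x) (hF0 : F 0 = 0) (hq : 1 < q) (hq2 : q ≤ 2)
    {R : ℝ} (hR : 0 < R) :
    ∃ K > (0 : ℝ), ∀ a b c, |a| ≤ R → |b| ≤ R →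
      |f (a + b) - f a - f b| * |c| ≤
        K * (|a * b * c| ^ ((2 : ℝ) / 3) + |a * c| ^ q + |b * c| ^ q) := by
  obtain ⟨K, hK, hB⟩ := h.exists_bounds hf hf0 hF hF0 hq hq2 hR
  set K' : ℝ := 5 * K * (R ^ (2 * q - 2) + 1) with hK'
  have hRq : 0 < R ^ (2 * q - 2) := by positivity
  have key : ∀ a b c, |a| ≤ R → |b| ≤ |a| →
      |f (a + b) - f a - f b| * |c| ≤
        K' * (|a * b * c| ^ ((2 : ℝ) / 3) + |a * c| ^ q + |b * c| ^ q) := by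
    intro a b c ha hb
    obtain ⟨h1, -, h3, -⟩ := hB a b ha hb
    have hp : |b| ^ (2 * q - 2) ≤ |a| ^ (2 * q - 2) :=
      Real.rpow_le_rpow (abs_nonneg b) hb (by linarith)
    have hp' : |a| ^ (2 * q - 2) ≤ R ^ (2 * q - 2) :=
      Real.rpow_le_rpow (abs_nonneg a) ha (by linarith)
    have h5 : |f (a + b) - f a - f b| * |c| ≤ 5 * K * (|a| ^ (2 * q - 2) * |b| * |c|) := by
      calc |f (a + b) - f a - f b| * |c| ≤ (|f (a + b) - f a| + |f b|) * |c| := by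
            gcongr
            exact abs_sub _ _
        _ ≤ (4 * K * |a| ^ (2 * q - 2) * |b| + K * |a| ^ (2 * q - 2) * |b|) * |c| := by
            gcongr
            exact h1.trans (by gcongr)
        _ = _ := by ring
    have t1 : 0 ≤ |a * b * c| ^ ((2 : ℝ) / 3) := by positivity
    have t2 : 0 ≤ |a * c| ^ q := by positivity
    have t3 : 0 ≤ |b * c| ^ q := by positivity
    have hmain : |a| ^ (2 * q - 2) * |b| * |c| ≤
        (R ^ (2 * q - 2) + 1) * (|a * b * c| ^ ((2 : ℝ) / 3) + |a * c| ^ q + |b * c| ^ q) := by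
      rcases le_total |c| |a| with hc | hc
      · have : |b| * |c| ≤ |a * b * c| ^ ((2 : ℝ) / 3) := by
          simpa only [abs_mul] using
            mul_le_rpow_two_thirds (abs_nonneg b) (abs_nonneg c) hb hc
        calc |a| ^ (2 * q - 2) * |b| * |c| = |a| ^ (2 * q - 2) * (|b| * |c|) := by ring
          _ ≤ R ^ (2 * q - 2) * |a * b * c| ^ ((2 : ℝ) / 3) := by gcongr
          _ ≤ _ := by
            gcongr
            · linarith
            · linarith
      · have := rpow_mul_mul_le_mul_rpow (abs_nonneg a) hc hq.le
        rw [← abs_mul, mul_comm c a] at this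
        calc |a| ^ (2 * q - 2) * |b| * |c| ≤ |a| ^ (2 * q - 2) * |a| * |c| := by gcongr
          _ ≤ 1 * |a * c| ^ q := by rwa [one_mul]
          _ ≤ _ := by
            gcongr
            · linarith
            · linarith
    calc _ ≤ _ := h5
      _ ≤ _ := mul_le_mul_of_nonneg_left hmain (by positivity)
      _ = _ := by rw [hK']; ring
  refine ⟨K', by positivity, fun a b c ha hb => ?_⟩
  rcases le_total |b| |a| with hab | hab
  · exact key a b c ha hab
  · have := key b a c hb hab
    rw [mul_comm b a, add_comm b a] at this
    convert this using 1
    · congr 2; ring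
    · ring

lemma abs_sum_le_of_abs_le {n : ℕ} {u : Fin n → ℝ} {R : ℝ} (hu : ∀ i, |u i| ≤ R) :
    |∑ i, u i| ≤ n * R :=
  (Finset.abs_sum_le_sum_abs _ _).trans ((Finset.sum_le_sum fun i _ => hu i).trans (by simp))

lemma DerivGrowth.exists_sum_mul (h : DerivGrowth f q) (hf : Differentiable ℝ f)
    (hf0 : f 0 = 0) (hF : ∀ x, HasDerivAt F (f x) x) (hF0 : F 0 = 0) (hq : 1 < q) (hq2 : q ≤ 2)
    {R : ℝ} (hR : 0 < R) (n : ℕ) :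
    ∃ K > (0 : ℝ), ∀ (u : Fin n → ℝ) (c : ℝ), (∀ i, |u i| ≤ R) →
      |f (∑ i, u i) - ∑ i, f (u i)| * |c| ≤
        K * ((∑ i, |u i * c| ^ q) + ∑ i : Fin n, ∑ j : Fin n,
          (if i < j then |u i * u j * c| ^ ((2 : ℝ) / 3) else 0)) := by
  induction n with
  | zero => exact ⟨1, one_pos, by simp [hf0]⟩
  | succ n ih =>
    obtain ⟨K₁, hK₁, h₁⟩ := ih
    obtain ⟨K₂, hK₂, h₂⟩ := h.exists_two_mul hf hf0 hF hF0 hq hq2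
      (by positivity : 0 < (n + 1 : ℝ) * R)
    obtain ⟨K₃, hK₃, h₃⟩ := exists_abs_sum_rpow_le n (by norm_num : (0 : ℝ) < 2 / 3)
    obtain ⟨K₄, hK₄, h₄⟩ := exists_abs_sum_rpow_le n (by linarith : (0 : ℝ) < q)
    refine ⟨K₁ + K₂ * (K₃ + K₄ + 1), by positivity, fun u c hu => ?_⟩
    simp only [Fin.sum_univ_castSucc, Fin.castSucc_lt_castSucc_iff, Fin.castSucc_lt_last,
      if_true, lt_irrefl, if_false, not_lt_of_gt (Fin.castSucc_lt_last _), add_zero,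
      Finset.sum_const_zero, Finset.sum_add_distrib]
    set v := fun i : Fin n => u i.castSucc with hv
    set w := u (Fin.last n) with hw
    have b₁ := h₁ v c fun i => hu _
    have hs : |∑ i, v i| ≤ (n + 1 : ℝ) * R :=
      (abs_sum_le_of_abs_le fun i => hu _).trans (by gcongr; linarith)
    have hwR : |w| ≤ (n + 1 : ℝ) * R := (hu _).trans (by nlinarith [n.cast_nonneg (α := ℝ)])
    have b₂ := h₂ (∑ i, v i) w c hs hwR
    have b₃ : |(∑ i, v i) * w * c| ^ ((2 : ℝ) / 3) ≤
        K₃ * ∑ i, |v i * w * c| ^ ((2 : ℝ) / 3) := by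
      simpa only [Finset.sum_mul] using h₃ fun i => v i * w * c
    have b₄ : |(∑ i, v i) * c| ^ q ≤ K₄ * ∑ i, |v i * c| ^ q := by
      simpa only [Finset.sum_mul] using h₄ fun i => v i * c
    set A := ∑ i, |v i * c| ^ q
    set B := ∑ i, |v i * w * c| ^ ((2 : ℝ) / 3)
    set D := ∑ i : Fin n, ∑ j : Fin n, (if i < j then |v i * v j * c| ^ ((2 : ℝ) / 3) else 0)
    have hA : 0 ≤ A := Finset.sum_nonneg fun i _ => by positivity
    have hB : 0 ≤ B := Finset.sum_nonneg fun i _ => by positivity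
    have hD : 0 ≤ D := Finset.sum_nonneg fun i _ => Finset.sum_nonneg fun j _ => by positivity
    have hE : 0 ≤ |w * c| ^ q := by positivity
    set E := |w * c| ^ q
    calc |f (∑ i, v i + w) - (∑ i, f (v i) + f w)| * |c|
        = |(f (∑ i, v i) - ∑ i, f (v i)) + (f (∑ i, v i + w) - f (∑ i, v i) - f w)| * |c| := by
          congr 2; ring
      _ ≤ |f (∑ i, v i) - ∑ i, f (v i)| * |c| +
          |f (∑ i, v i + w) - f (∑ i, v i) - f w| * |c| := by
          rw [← add_mul]
          gcongr
          exact abs_add_le _ _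
      _ ≤ K₁ * (A + D) + K₂ * (K₃ * B + K₄ * A + E) :=
          add_le_add b₁ (b₂.trans (by gcongr))
      _ ≤ K₁ * (A + E + (D + B)) + K₂ * ((K₃ + K₄ + 1) * (A + E + (D + B))) := by
          gcongr
          · linarith
          · linarith
          · nlinarith [mul_nonneg hK₃.le hA, mul_nonneg hK₃.le hD, mul_nonneg hK₃.le hE,
              mul_nonneg hK₄.le hB, mul_nonneg hK₄.le hD, mul_nonneg hK₄.le hE]
      _ = _ := by ring

lemma DerivGrowth.exists_sum_primitive (h : DerivGrowth f q) (hf : Differentiable ℝ f)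
    (hf0 : f 0 = 0) (hF : ∀ x, HasDerivAt F (f x) x) (hF0 : F 0 = 0) (hq : 1 < q) (hq2 : q ≤ 2)
    {R : ℝ} (hR : 0 < R) (n : ℕ) :
    ∃ K > (0 : ℝ), ∀ u : Fin n → ℝ, (∀ i, |u i| ≤ R) →
      |F (∑ i, u i) - ∑ i, F (u i)
          - ∑ i : Fin n, ∑ j : Fin n, (if i ≠ j then f (u i) * u j else 0)|
        ≤ K * ((∑ i : Fin n, ∑ j : Fin n, (if i < j then |u i * u j| ^ q else 0))
            + ∑ i : Fin n, ∑ j : Fin n, ∑ k : Fin n,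
              (if i < j ∧ j < k then |u i * u j * u k| ^ ((2 : ℝ) / 3) else 0)) := by
  induction n with
  | zero => exact ⟨1, one_pos, by simp [hF0]⟩
  | succ n ih =>
    obtain ⟨K₁, hK₁, h₁⟩ := ih
    obtain ⟨K₂, hK₂, h₂⟩ := h.exists_two_primitive hf hf0 hF hF0 hq hq2
      (by positivity : 0 < (n + 1 : ℝ) * R)
    obtain ⟨K₃, hK₃, h₃⟩ := h.exists_sum_mul hf hf0 hF hF0 hq hq2 hR n
    obtain ⟨K₄, hK₄, h₄⟩ := exists_abs_sum_rpow_le n (by linarith : (0 : ℝ) < q)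
    refine ⟨K₁ + K₂ * K₄ + K₃, by positivity, fun u hu => ?_⟩
    simp only [Fin.sum_univ_castSucc, Fin.castSucc_lt_castSucc_iff, Fin.castSucc_lt_last,
      if_true, lt_irrefl, if_false, not_lt_of_gt (Fin.castSucc_lt_last _), add_zero, and_true,
      and_false, false_and, ne_eq, Fin.castSucc_inj, not_true_eq_false, not_false_eq_true,
      (Fin.castSucc_lt_last _).ne, (Fin.castSucc_lt_last _).ne',
      Finset.sum_const_zero, Finset.sum_add_distrib]
    set v := fun i : Fin n => u i.castSucc with hv
    set w := u (Fin.last n) with hw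
    have b₁ := h₁ v fun i => hu _
    have hs : |∑ i, v i| ≤ (n + 1 : ℝ) * R :=
      (abs_sum_le_of_abs_le fun i => hu _).trans (by gcongr; linarith)
    have hwR : |w| ≤ (n + 1 : ℝ) * R := (hu _).trans (by nlinarith [n.cast_nonneg (α := ℝ)])
    have b₂ := h₂ (∑ i, v i) w hs hwR
    have b₃ := h₃ v w fun i => hu _
    have b₄ : |(∑ i, v i) * w| ^ q ≤ K₄ * ∑ i, |v i * w| ^ q := by
      simpa only [Finset.sum_mul] using h₄ fun i => v i * w
    simp only [ne_eq] at b₁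
    set G := ∑ i : Fin n, ∑ j : Fin n, (if ¬ i = j then f (v i) * v j else 0)
    set A := ∑ i, |v i * w| ^ q
    set B := ∑ i : Fin n, ∑ j : Fin n, (if i < j then |v i * v j| ^ q else 0)
    set D := ∑ i : Fin n, ∑ j : Fin n, (if i < j then |v i * v j * w| ^ ((2 : ℝ) / 3) else 0)
    set E := ∑ i : Fin n, ∑ j : Fin n, ∑ k : Fin n,
      (if i < j ∧ j < k then |v i * v j * v k| ^ ((2 : ℝ) / 3) else 0)
    have hA : 0 ≤ A := Finset.sum_nonneg fun i _ => by positivity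
    have hB : 0 ≤ B := Finset.sum_nonneg fun i _ => Finset.sum_nonneg fun j _ => by positivity
    have hD : 0 ≤ D := Finset.sum_nonneg fun i _ => Finset.sum_nonneg fun j _ => by positivity
    have hE : 0 ≤ E := Finset.sum_nonneg fun i _ => Finset.sum_nonneg fun j _ =>
      Finset.sum_nonneg fun k _ => by positivity
    rw [← abs_mul] at b₃
    rw [← Finset.sum_mul, ← Finset.mul_sum]
    calc |F (∑ i, v i + w) - (∑ i, F (v i) + F w) -
          (G + f w * ∑ i, v i + (∑ i, f (v i)) * w)|
        = |(F (∑ i, v i) - ∑ i, F (v i) - G) +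
            (F (∑ i, v i + w) - F (∑ i, v i) - F w - f (∑ i, v i) * w - f w * ∑ i, v i) +
            (f (∑ i, v i) - ∑ i, f (v i)) * w| := by
          congr 1; ring
      _ ≤ K₁ * (B + E) + K₂ * (K₄ * A) + K₃ * (A + D) :=
          (abs_add_three _ _ _).trans
            (add_le_add (add_le_add b₁ (b₂.trans (by gcongr))) b₃)
      _ ≤ K₁ * (B + A + (E + D)) + K₂ * (K₄ * (B + A + (E + D))) + K₃ * (B + A + (E + D)) := by
          gcongr <;> linarith
      _ = _ := by ring

end

lemma le_of_forall_ne_zero_le {g h : ℝ → ℝ} (hg : Continuous g) (hh : Continuous h)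
    (hgh : ∀ u ≠ 0, g u ≤ h u) (u : ℝ) : g u ≤ h u := by
  have hcl : closure ({0}ᶜ : Set ℝ) ⊆ {u | g u ≤ h u} :=
    closure_minimal (fun u hu => hgh u hu) (isClosed_le hg hh)
  rw [(dense_compl_singleton (0 : ℝ)).closure_eq] at hcl
  exact hcl (Set.mem_univ u)

lemma rpow_le_mul_rpow_of_le {x R r s t : ℝ} (hx : 0 ≤ x) (hxR : x ≤ R) (hR : 1 ≤ R)
    (hs : 0 < s) (hsr : s ≤ r) (hrt : r ≤ t) : x ^ r ≤ R ^ t * x ^ s := by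
  calc x ^ r = x ^ (r - s) * x ^ s := by
        rw [← Real.rpow_add_of_nonneg hx (by linarith) hs.le, sub_add_cancel]
    _ ≤ R ^ (r - s) * x ^ s := by
        have := Real.rpow_le_rpow hx hxR (by linarith : 0 ≤ r - s)
        gcongr
    _ ≤ R ^ t * x ^ s := by
        have := Real.rpow_le_rpow_of_exponent_le hR (by linarith : r - s ≤ t)
        gcongr


theorem stmt_5 (f : ℝ → ℝ) (C p₁ p₂ : ℝ) (hC : 0 < C) (hp₁ : 1 < p₁) (hp₁₂ : p₁ ≤ p₂)
    (hf1 : ContDiff ℝ 1 f) (hf3 : ContDiffOn ℝ 3 f {(0 : ℝ)}ᶜ)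
    (hbound : ∀ k : ℕ, k ≤ 3 → ∀ u : ℝ, u ≠ 0 →
      |iteratedDeriv k f u| ≤ C * (|u| ^ (p₁ - (k : ℝ)) + |u| ^ (p₂ - (k : ℝ))))
    (F : ℝ → ℝ) (hF : ∀ u : ℝ, F u = ∫ s in (0 : ℝ)..u, f s) :
    ∀ C₁ : ℝ, 1 ≤ C₁ → ∀ n : ℕ, ∃ C₂ > (0 : ℝ), ∀ u : Fin n → ℝ,
      (∀ i, |u i| ≤ C₁) →
      |F (∑ i, u i) - ∑ i, F (u i)
          - ∑ i : Fin n, ∑ j : Fin n, (if i ≠ j then f (u i) * u j else 0)|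
        ≤ C₂ * ((∑ i : Fin n, ∑ j : Fin n,
              (if i < j then |u i * u j| ^ (2 * min ((p₁ + 1) / 4) 1) else 0))
            + ∑ i : Fin n, ∑ j : Fin n, ∑ k : Fin n,
              (if i < j ∧ j < k then |u i * u j * u k| ^ ((2 : ℝ) / 3) else 0)) := by
  have hf := hf1.differentiable one_ne_zero
  have hcont : ∀ r : ℝ, 0 ≤ r → Continuous fun u : ℝ => |u| ^ r := fun r hr =>
    continuous_abs.rpow_const fun _ => Or.inr hr
  have hf0 : f 0 = 0 := by
    have := le_of_forall_ne_zero_le (g := fun u => |f u|)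
      (h := fun u => C * (|u| ^ p₁ + |u| ^ p₂)) hf1.continuous.abs
      (continuous_const.mul ((hcont p₁ (by linarith)).add (hcont p₂ (by linarith))))
      (fun u hu => by simpa using hbound 0 (by norm_num) u hu) 0
    rw [abs_zero, Real.zero_rpow (by linarith), Real.zero_rpow (by linarith)] at this
    simpa using this
  have hd := le_of_forall_ne_zero_le (g := fun u => |deriv f u|)
    (h := fun u => C * (|u| ^ (p₁ - 1) + |u| ^ (p₂ - 1))) (hf1.continuous_deriv le_rfl).abs
    (continuous_const.mul ((hcont _ (by linarith)).add (hcont _ (by linarith))))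
    (fun u hu => by simpa using hbound 1 (by norm_num) u hu)
  have hFd : ∀ x, HasDerivAt F (f x) x := fun x => by
    rw [funext hF]
    exact hf1.continuous.integral_hasStrictDerivAt 0 x |>.hasDerivAt
  have hq : 1 < 2 * min ((p₁ + 1) / 4) 1 := by
    have : 1 / 2 < min ((p₁ + 1) / 4) 1 := lt_min (by linarith) (by norm_num)
    linarith
  have hq2 : 2 * min ((p₁ + 1) / 4) 1 ≤ 2 := by linarith [min_le_right ((p₁ + 1) / 4) 1]
  have hqp : 2 * min ((p₁ + 1) / 4) 1 ≤ (p₁ + 1) / 2 := by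
    linarith [min_le_left ((p₁ + 1) / 4) 1]
  have hgrowth : DerivGrowth f (2 * min ((p₁ + 1) / 4) 1) := by
    generalize 2 * min ((p₁ + 1) / 4) 1 = q at *
    intro R hR
    refine ⟨C * (2 * (R + 1) ^ p₂), by positivity, fun u hu => (hd u).trans ?_⟩
    rw [mul_assoc]
    refine mul_le_mul_of_nonneg_left ?_ hC.le
    have e₁ := rpow_le_mul_rpow_of_le (abs_nonneg u) (by linarith : |u| ≤ R + 1) (by linarith)
      (by linarith : 0 < 2 * q - 2) (by linarith : 2 * q - 2 ≤ p₁ - 1)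
      (by linarith : p₁ - 1 ≤ p₂)
    have e₂ := rpow_le_mul_rpow_of_le (abs_nonneg u) (by linarith : |u| ≤ R + 1) (by linarith)
      (by linarith : 0 < 2 * q - 2) (by linarith : 2 * q - 2 ≤ p₂ - 1)
      (by linarith : p₂ - 1 ≤ p₂)
    linarith
  intro C₁ hC₁ n
  exact hgrowth.exists_sum_primitive hf hf0 hFd (by simp [hF]) hq hq2 (by linarith) n
end
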